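/- Let X be a shift space over a finite alphabet with left shift σ. For any mistake function g : ℕ → ℕ, there is a sequence of positive numbers δ_n → 0 such that whenever x, y ∈ X and m, n ∈ ℕ satisfy d̂(x₁⋯x_n, y₁⋯y_m) ≤ g(n), then D(ℰ_n(x), ℰ_m(y)) ≤ δ_n, where D is the metric on Borel probability measures given by D(μ,ν) = ∑_{k≥1} 2^{−k} |∫ f_k dμ − ∫ f_k dν| for a fixed countable separating family {f_k} of continuous functions with 0 ≤ f_k ≤ 1. -/

import Mathlib

open MeasureTheory Filter Topology Set
open scoped ENNReal Classical

namespace Paper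

variable {A : Type} [Fintype A] [DecidableEq A] [TopologicalSpace A] [DiscreteTopology A]
  [MeasurableSpace A] [BorelSpace A]

/-- The left shift map on the full shift `A^ℕ`. -/
def shift : (ℕ → A) → (ℕ → A) := fun x i => x (i + 1)

/-- The cylinder set of a finite word `w`: points whose initial word is `w`. -/
def cylinder (w : List A) : Set (ℕ → A) := {x | ∀ i : Fin w.length, x i = w.get i}

/-- The language of `X`: finite words `w` with `[w] ∩ X ≠ ∅`. -/
def language (X : Set (ℕ → A)) : Set (List A) := {w | (cylinder w ∩ X).Nonempty}

/-- One edit of a word: a substitution, an insertion, or a deletion. -/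
def EditStep (w w' : List A) : Prop :=
  (∃ u₁ u₂ : List A, ∃ a a' : A, w = u₁ ++ [a] ++ u₂ ∧ w' = u₁ ++ [a'] ++ u₂) ∨
  (∃ u₁ u₂ : List A, ∃ a' : A, w = u₁ ++ u₂ ∧ w' = u₁ ++ [a'] ++ u₂) ∨
  (∃ u₁ u₂ : List A, ∃ a : A, w = u₁ ++ [a] ++ u₂ ∧ w' = u₁ ++ u₂)

/-- The edit distance: the minimal number of edits transforming `v` into `w`. -/
noncomputable def editDist (v w : List A) : ℕ :=
  sInf {n | ∃ f : ℕ → List A, f 0 = v ∧ f n = w ∧ ∀ i < n, EditStep (f i) (f (i + 1))}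

/-- `G ⊆ L` has (W)-specification (with some gap length `τ`). -/
def HasSpecW (L G : Set (List A)) : Prop :=
  ∃ τ : ℕ, ∀ v ∈ G, ∀ w ∈ G, ∃ u ∈ L, u.length ≤ τ ∧ v ++ u ++ w ∈ G

/-- A mistake function: nondecreasing with `g n / n → 0`. -/
def MistakeFun (g : ℕ → ℕ) : Prop :=
  Monotone g ∧ Tendsto (fun n => (g n : ℝ) / n) atTop (𝓝 0)

/-- `L` is edit approachable by `G`. -/
def EditApproachable (L G : Set (List A)) : Prop :=
  ∃ g : ℕ → ℕ, MistakeFun g ∧ ∀ w ∈ L, ∃ v ∈ G, editDist v w ≤ g w.length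

/-- The shift map restricted to a (shift-invariant) subset `X`, as a self-map of `↥X`. -/
noncomputable def subShift (X : Set (ℕ → A)) : ↥X → ↥X := fun x =>
  if h : shift x.val ∈ X then ⟨shift x.val, h⟩ else x

/-- Birkhoff sum `S_n φ = ∑_{i<n} φ ∘ σ^i`. -/
def birkhoff {Y : Type*} (σ : Y → Y) (φ : Y → ℝ) (n : ℕ) (y : Y) : ℝ :=
  ∑ i ∈ Finset.range n, φ (σ^[i] y)

/-- The Birkhoff average `(1/n) S_n φ`. -/
noncomputable def birkAvg {Y : Type*} (σ : Y → Y) (φ : Y → ℝ) (n : ℕ) (y : Y) : ℝ :=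
  (n : ℝ)⁻¹ * birkhoff σ φ n y

/-- Carathéodory sum `M(Z,t,φ,N)` over covers of `Z` by cylinders of length `> N`. -/
noncomputable def Mcal (X : Set (ℕ → A)) (φ : ↥X → ℝ) (Z : Set ↥X) (t : ℝ) (N : ℕ) : ℝ≥0∞ :=
  ⨅ (S : Set (List A)) (_ : S.Countable) (_ : ∀ w ∈ S, N < w.length)
    (_ : Z ⊆ ⋃ w ∈ S, Subtype.val ⁻¹' cylinder w),
    ∑' w : S, ENNReal.ofReal (Real.exp (-t * (w : List A).length +
      sSup (birkhoff (subShift X) φ (w : List A).length ''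
        (Subtype.val ⁻¹' cylinder (w : List A)))))

/-- `M(Z,t,φ) = lim_{N→∞} M(Z,t,φ,N)` (the limit of a nondecreasing quantity). -/
noncomputable def McalLim (X : Set (ℕ → A)) (φ : ↥X → ℝ) (Z : Set ↥X) (t : ℝ) : ℝ≥0∞ :=
  ⨆ N : ℕ, Mcal X φ Z t N

/-- The topological pressure `P_Z(φ)` of `Z ⊆ X`. -/
noncomputable def pressure (X : Set (ℕ → A)) (φ : ↥X → ℝ) (Z : Set ↥X) : ℝ :=
  sInf {t : ℝ | McalLim X φ Z t = 0}

/-- The empirical measure `ℰ_n(x) = (1/n) ∑_{i<n} δ_{σ^i x}`. -/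
noncomputable def empiric {Y : Type*} [MeasurableSpace Y] (σ : Y → Y) (n : ℕ) (x : Y) :
    Measure Y := (n : ℝ≥0∞)⁻¹ • ∑ i ∈ Finset.range n, Measure.dirac (σ^[i] x)

/-- The set `A(ℰ_n(x))` of weak* limit points of the sequence of empirical measures of `x`:
probability measures that are limits of the empirical measures along a subsequence. -/
def limitPts {Y : Type*} [MeasurableSpace Y] [TopologicalSpace Y] (σ : Y → Y) (x : Y) :
    Set (ProbabilityMeasure Y) :=
  {μ | ∃ φ : ℕ → ℕ, StrictMono φ ∧ ∀ f : C(Y, ℝ),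
      Tendsto (fun k => birkAvg σ (fun y => f y) (φ k) x) atTop (𝓝 (∫ y, f y ∂μ.toMeasure))}

/-- The saturated set `G_K = {x : A(ℰ_n(x)) = K}`. -/
def saturated {Y : Type*} [MeasurableSpace Y] [TopologicalSpace Y] (σ : Y → Y)
    (K : Set (ProbabilityMeasure Y)) : Set Y := {x | limitPts σ x = K}

/-- The generic points of `μ`: those `x` with `ℰ_n(x) → μ` in the weak* topology. -/
def genericPts {Y : Type*} [MeasurableSpace Y] [TopologicalSpace Y] (σ : Y → Y)
    (μ : ProbabilityMeasure Y) : Set Y :=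
  {x | ∀ f : C(Y, ℝ),
      Tendsto (fun n => birkAvg σ (fun y => f y) n x) atTop (𝓝 (∫ y, f y ∂μ.toMeasure))}

/-- `μ` is a `σ`-invariant (probability) measure. -/
def IsInvariant {Y : Type*} [MeasurableSpace Y] (σ : Y → Y) (μ : ProbabilityMeasure Y) : Prop :=
  μ.toMeasure.map σ = μ.toMeasure

/-- The level set `X(ψ,α)` of points whose Birkhoff averages of `ψ` converge to `α`. -/
def levelSet {Y : Type*} (σ : Y → Y) (ψ : Y → ℝ) (α : ℝ) : Set Y :=
  {x | Tendsto (fun n => birkAvg σ ψ n x) atTop (𝓝 α)}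

/-- The irregular set `X̂(ψ)` of points whose Birkhoff averages of `ψ` do not converge. -/
def irregular {Y : Type*} (σ : Y → Y) (ψ : Y → ℝ) : Set Y :=
  {x | ¬ ∃ α : ℝ, Tendsto (fun n => birkAvg σ ψ n x) atTop (𝓝 α)}

/-- The cylinder of a word of length `n` given as `w : Fin n → A`. -/
def cylF {n : ℕ} (w : Fin n → A) : Set (ℕ → A) := {x | ∀ i : Fin n, x i = w i}

/-- The entropy `H_n(μ)` of the partition of `X` into cylinders of length `n`. -/
noncomputable def wordEntropy (X : Set (ℕ → A)) (μ : ProbabilityMeasure ↥X) (n : ℕ) : ℝ :=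
  ∑ w : Fin n → A, Real.negMulLog ((μ.toMeasure (Subtype.val ⁻¹' cylF w)).toReal)

/-- The measure-theoretic (Kolmogorov–Sinai) entropy `h_μ(σ)` of a shift-invariant measure on a
subshift: by subadditivity, `lim_n H_n/n = inf_{n ≥ 1} H_n/n`. -/
noncomputable def entropy (X : Set (ℕ → A)) (μ : ProbabilityMeasure ↥X) : ℝ :=
  ⨅ n : ℕ, wordEntropy X μ (n + 1) / (n + 1)

/-- The distance `D` on measures induced by a countable family of continuous functions. -/
noncomputable def Dmetric {Y : Type*} [MeasurableSpace Y] [TopologicalSpace Y]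
    (f : ℕ → C(Y, ℝ)) (μ ν : Measure Y) : ℝ :=
  ∑' k : ℕ, ((2 : ℝ) ^ (k + 1))⁻¹ * |(∫ y, f k y ∂μ) - ∫ y, f k y ∂ν|

/-- The family `f` is separating: `D` separates Borel probability measures. -/
def Separating {Y : Type*} [MeasurableSpace Y] [TopologicalSpace Y] (f : ℕ → C(Y, ℝ)) : Prop :=
  ∀ μ ν : ProbabilityMeasure Y,
    (∀ k, (∫ y, f k y ∂μ.toMeasure) = ∫ y, f k y ∂ν.toMeasure) → μ = ν

/-- Diameter of a set with respect to a distance function `d`, valued in `ℝ≥0∞`. -/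
noncomputable def ediam {Y : Type*} (d : Y → Y → ℝ) (U : Set Y) : ℝ≥0∞ :=
  ⨆ x ∈ U, ⨆ y ∈ U, ENNReal.ofReal (d x y)

/-- The `s`-dimensional Hausdorff pre-measure at scale `ε` w.r.t. the distance `d`. -/
noncomputable def hMeasAux {Y : Type*} (d : Y → Y → ℝ) (s : ℝ) (ε : ℝ≥0∞) (Z : Set Y) : ℝ≥0∞ :=
  ⨅ (C : ℕ → Set Y) (_ : Z ⊆ ⋃ n, C n) (_ : ∀ n, ediam d (C n) ≤ ε),
    ∑' n, ⨆ (_ : (C n).Nonempty), ediam d (C n) ^ s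

/-- The `s`-dimensional Hausdorff measure w.r.t. the distance `d`. -/
noncomputable def hMeas {Y : Type*} (d : Y → Y → ℝ) (s : ℝ) (Z : Set Y) : ℝ≥0∞ :=
  ⨆ (ε : ℝ≥0∞) (_ : 0 < ε), hMeasAux d s ε Z

/-- The Hausdorff dimension of `Z` w.r.t. the distance `d`. -/
noncomputable def hdim {Y : Type*} (d : Y → Y → ℝ) (Z : Set Y) : ℝ :=
  sInf {s : ℝ | 0 ≤ s ∧ hMeas d s Z = 0}

/-- The length `|x ∧ y|` of the longest common prefix of two distinct points. -/
noncomputable def wedge (x y : ℕ → A) : ℕ := sInf {n | x n ≠ y n}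

/-- The Gatzouras–Peres distance `d_φ` associated with a strictly positive continuous `φ`. -/
noncomputable def dphi (X : Set (ℕ → A)) (φ : ↥X → ℝ) (x y : ↥X) : ℝ :=
  if x = y then 0
  else Real.exp (-(sSup (birkhoff (subShift X) φ (wedge x.val y.val) ''
      {z : ↥X | ∀ i < wedge x.val y.val, z.val i = x.val i})))

/-- The word `w` occurs in `x` at position `k`. -/
def occursAt (w : List A) (x : ℕ → A) (k : ℕ) : Prop :=
  ∀ i : Fin w.length, x (k + i) = w.get i

/-- A shift of finite type: determined by a finite set of forbidden words. -/
def IsSFT {B : Type} (Z : Set (ℕ → B)) : Prop :=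
  ∃ F : Set (List B), F.Finite ∧ Z = {x | ∀ w ∈ F, ∀ k, ¬ occursAt w x k}

/-- A sofic shift: the image of a shift of finite type under a sliding block code. -/
def IsSofic (Y : Set (ℕ → A)) : Prop :=
  ∃ (B : Type) (_ : Fintype B) (Z : Set (ℕ → B)) (π : (ℕ → B) → (ℕ → A)),
    IsSFT Z ∧ Set.MapsTo shift Z Z ∧
    (∃ r : ℕ, ∀ z ∈ Z, ∀ z' ∈ Z, ∀ k, (∀ i ≤ k + r, z i = z' i) → π z k = π z' k) ∧
    (∀ z ∈ Z, π (shift z) = shift (π z)) ∧ π '' Z = Y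

/-- Topological transitivity of a subshift, via its language. -/
def IsTransitive (Y : Set (ℕ → A)) : Prop :=
  ∀ u ∈ language Y, ∀ v ∈ language Y, ∃ w : List A, u ++ w ++ v ∈ language Y

/-- The prefix of length `n` of `x`, as a word. -/
def prefixWord (x : ℕ → A) (n : ℕ) : List A := List.ofFn fun i : Fin n => x i

/-- The norm `‖m‖ = sup_{0 < ‖f‖ ≤ 1} |∫ f dm| / ‖f‖` of a measure on a compact space. -/
noncomputable def mnorm {Y : Type*} [TopologicalSpace Y] [CompactSpace Y] [MeasurableSpace Y]
    (m : Measure Y) : ℝ :=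
  sSup ((fun f : C(Y, ℝ) => |∫ y, f y ∂m| / ‖f‖) '' {f : C(Y, ℝ) | 0 < ‖f‖ ∧ ‖f‖ ≤ 1})

/-- Strict lexicographic order on `ℕ`-indexed sequences of naturals. -/
def lexLt (x y : ℕ → ℕ) : Prop := ∃ n : ℕ, (∀ i < n, x i = y i) ∧ x n < y n

/-- The β-shift: all sequences over `{0, …, b-1}` all of whose shifts are lexicographically
below the expansion `w` of `1` in base `β` (where `b = ⌈β⌉`). -/
def betaShift (b : ℕ) (w : ℕ → ℕ) : Set (ℕ → Fin b) :=
  {x | ∀ j : ℕ, 1 ≤ j → lexLt (fun i => ((shift^[j] x) i : ℕ)) w}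

/-- The S-gap shift: sequences over `{0,1}` such that the number of `0`s between any two
consecutive `1`s lies in `S`. -/
def sGapShift (S : Set ℕ) : Set (ℕ → Fin 2) :=
  {x | ∀ k l : ℕ, k < l → x k = 1 → x l = 1 →
    (∀ m : ℕ, k < m → m < l → x m = 0) → l - k - 1 ∈ S}


section EditPaths

variable {B : Type}

theorem exists_editStep_path (v w : List B) :
    ∃ f : ℕ → List B, f 0 = v ∧ f (v.length + w.length) = w ∧
      ∀ i < v.length + w.length, EditStep (f i) (f (i + 1)) := by
  refine ⟨fun i => if i < v.length then v.drop i else w.drop (w.length - (i - v.length)),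
    ?_, by simp, ?_⟩
  · by_cases h : 0 < v.length
    · simp [h]
    · have : v = [] := by simpa using h
      simp [this]
  · intro i hi
    by_cases h : i < v.length
    · refine Or.inr (Or.inr ⟨[], v.drop (i + 1), v[i], ?_, ?_⟩)
      · simp [h]
      · by_cases h' : i + 1 < v.length
        · simp [h']
        · have : i + 1 = v.length := by omega
          simp [this]
    · refine Or.inr (Or.inl ⟨[], w.drop (w.length - (i - v.length)),
        w[w.length - (i + 1 - v.length)]'(by omega), ?_, ?_⟩)
      · simp [h]
      · have h' : ¬ i + 1 < v.length := by omega
        have h'' : w.length - (i - v.length) = w.length - (i + 1 - v.length) + 1 := by omega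
        simp only [h', if_false, h'', List.nil_append, List.singleton_append]
        exact List.drop_eq_getElem_cons (by omega)

theorem abs_sub_le_mul_editDist (Φ : List B → ℝ) (C : ℝ)
    (hΦ : ∀ w w', EditStep w w' → |Φ w - Φ w'| ≤ C) (v w : List B) :
    |Φ v - Φ w| ≤ C * editDist v w := by
  obtain ⟨f, hf0, hfn, hf⟩ : editDist v w ∈ {n | ∃ f : ℕ → List B, f 0 = v ∧ f n = w ∧
      ∀ i < n, EditStep (f i) (f (i + 1))} := Nat.sInf_mem ⟨_, exists_editStep_path v w⟩
  have key : ∀ n ≤ editDist v w, |Φ (f 0) - Φ (f n)| ≤ C * n := by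
    intro n
    induction n with
    | zero => simp
    | succ n ih =>
      intro hn
      have h1 := ih (by omega)
      have h2 := hΦ _ _ (hf n (by omega))
      have h3 := abs_sub_le (Φ (f 0)) (Φ (f n)) (Φ (f (n + 1)))
      push_cast
      linarith
  simpa [hf0, hfn] using key _ le_rfl

theorem abs_length_sub_length_le_editDist (v w : List B) :
    |(v.length : ℝ) - w.length| ≤ editDist v w := by
  have := abs_sub_le_mul_editDist (fun u : List B => (u.length : ℝ)) 1 ?_ v w
  · simpa using this
  · rintro _ _ (⟨u₁, u₂, a, a', rfl, rfl⟩ | ⟨u₁, u₂, a', rfl, rfl⟩ | ⟨u₁, u₂, a, rfl, rfl⟩)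
    all_goals simp only [List.length_append, List.length_singleton]; push_cast; rw [abs_le]
    all_goals constructor <;> linarith

/-- The sum of `F` over the blocks of length `N` of a word (truncated at its end). -/
def blockSum (F : List B → ℝ) (N : ℕ) : List B → ℝ
  | [] => 0
  | a :: w => F ((a :: w).take N) + blockSum F N w

variable {F : List B → ℝ}

theorem abs_blockSum_append_sub_le (hF : ∀ w, F w ∈ Set.Icc (0 : ℝ) 1) (N : ℕ) (u v : List B) :
    |blockSum F N (u ++ v) - (blockSum F N u + blockSum F N v)| ≤ min (u.length : ℝ) N := by
  induction u with
  | nil => simp [blockSum]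
  | cons a u ih =>
    simp only [List.cons_append, blockSum]
    by_cases h : N ≤ u.length + 1
    · have h1 : (a :: (u ++ v)).take N = (a :: u).take N := by
        rw [← List.cons_append, List.take_append_of_le_length (by simpa using h)]
      rw [h1]
      have h2 : min (u.length : ℝ) N ≤ min ((a :: u).length : ℝ) N :=
        min_le_min_right _ (by simp)
      refine le_trans (le_of_eq ?_) (ih.trans h2)
      congr 1
      ring
    · have h1 : min (u.length : ℝ) N = u.length := min_eq_left (by exact_mod_cast (by omega))
      have h2 : min ((a :: u).length : ℝ) N = u.length + 1 := by
        rw [min_eq_left (by simp; exact_mod_cast (by omega : u.length + 1 ≤ N))]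
        simp
      rw [h2]
      rw [h1, abs_le] at ih
      have h3 := hF ((a :: (u ++ v)).take N)
      have h4 := hF ((a :: u).take N)
      rw [abs_le]
      constructor <;> linarith [h3.1, h3.2, h4.1, h4.2]

theorem abs_blockSum_sub_le_of_editStep (hF : ∀ w, F w ∈ Set.Icc (0 : ℝ) 1) (N : ℕ)
    {w w' : List B} (h : EditStep w w') :
    |blockSum F N w - blockSum F N w'| ≤ 4 * N + 1 := by
  have h2 (u v : List B) :
      |blockSum F N (u ++ v) - (blockSum F N u + blockSum F N v)| ≤ N :=
    (abs_blockSum_append_sub_le hF N u v).trans (min_le_right _ _)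
  have h1 (a : B) : blockSum F N [a] ∈ Set.Icc (0 : ℝ) 1 := by
    simpa [blockSum] using hF ([a].take N)
  have h3 (u v : List B) (a : B) : |blockSum F N (u ++ [a] ++ v) -
      (blockSum F N u + blockSum F N [a] + blockSum F N v)| ≤ 2 * N := by
    have e1 := abs_le.1 (h2 (u ++ [a]) v)
    have e2 := abs_le.1 (h2 u [a])
    rw [abs_le]
    constructor <;> linarith
  have hN : (0 : ℝ) ≤ N := N.cast_nonneg
  rcases h with ⟨u₁, u₂, a, a', rfl, rfl⟩ | ⟨u₁, u₂, a', rfl, rfl⟩ | ⟨u₁, u₂, a, rfl, rfl⟩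
  · have e1 := abs_le.1 (h3 u₁ u₂ a)
    have e2 := abs_le.1 (h3 u₁ u₂ a')
    have e3 := h1 a
    have e4 := h1 a'
    rw [abs_le]
    constructor <;> linarith [e3.1, e3.2, e4.1, e4.2]
  · have e1 := abs_le.1 (h2 u₁ u₂)
    have e2 := abs_le.1 (h3 u₁ u₂ a')
    have e3 := h1 a'
    rw [abs_le]
    constructor <;> linarith [e3.1, e3.2]
  · have e1 := abs_le.1 (h2 u₁ u₂)
    have e2 := abs_le.1 (h3 u₁ u₂ a)
    have e3 := h1 a
    rw [abs_le]
    constructor <;> linarith [e3.1, e3.2]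

end EditPaths

section Prefixes

variable {B : Type}

@[simp] theorem length_prefixWord (x : ℕ → B) (n : ℕ) : (prefixWord x n).length = n := by
  simp [prefixWord]

theorem prefixWord_succ (x : ℕ → B) (n : ℕ) :
    prefixWord x (n + 1) = x 0 :: prefixWord (shift x) n := by
  simp [prefixWord, List.ofFn_succ, shift]

theorem take_prefixWord (x : ℕ → B) {N n : ℕ} (h : N ≤ n) :
    (prefixWord x n).take N = prefixWord x N := by
  apply List.ext_getElem
  · simpa using h
  · intro i h1 h2
    simp [prefixWord]

theorem prefixWord_eq_iff (x y : ℕ → B) (n : ℕ) :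
    prefixWord x n = prefixWord y n ↔ ∀ i < n, x i = y i := by
  rw [prefixWord, prefixWord, List.ofFn_inj, funext_iff]
  exact ⟨fun h i hi => h ⟨i, hi⟩, fun h i => h i i.2⟩

theorem subShift_val {X : Set (ℕ → B)} (hX : Set.MapsTo shift X X) (x : X) :
    (subShift X x).val = shift x.val := by
  simp [subShift, hX x.2]

theorem exists_prefix_uniform {A : Type} [Finite A] [TopologicalSpace A] [DiscreteTopology A]
    {X : Set (ℕ → A)} (hX : IsClosed X) (φ : C(X, ℝ)) {ε : ℝ} (hε : 0 < ε) :
    ∃ N : ℕ, ∀ x y : X, prefixWord x.val N = prefixWord y.val N → |φ x - φ y| ≤ ε := by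
  let _ : MetricSpace (ℕ → A) := PiNat.metricSpace
  have : CompactSpace X := isCompact_iff_compactSpace.1 hX.isCompact
  obtain ⟨η, hη, h⟩ := Metric.uniformContinuous_iff.1
    (CompactSpace.uniformContinuous_of_continuous φ.continuous) ε hε
  obtain ⟨N, hN⟩ := exists_pow_lt_of_lt_one hη (by norm_num : (1 / 2 : ℝ) < 1)
  refine ⟨N, fun x y hxy => ?_⟩
  have h1 : dist x.val y.val ≤ (1 / 2) ^ N :=
    PiNat.mem_cylinder_iff_dist_le.1 ((prefixWord_eq_iff _ _ _).1 hxy)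
  have h2 : dist x y < η := h1.trans_lt hN
  exact (h h2).le

theorem exists_blockFun {X : Set (ℕ → B)} {φ : X → ℝ} (hφ : ∀ x, φ x ∈ Set.Icc (0 : ℝ) 1)
    {N : ℕ} {ε : ℝ}
    (h : ∀ x y : X, prefixWord x.val N = prefixWord y.val N → |φ x - φ y| ≤ ε) :
    ∃ F : List B → ℝ, (∀ w, F w ∈ Set.Icc (0 : ℝ) 1) ∧
      ∀ x : X, |φ x - F (prefixWord x.val N)| ≤ ε := by
  refine ⟨fun w => if hw : ∃ z : X, prefixWord z.val N = w then φ hw.choose else 0,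
    fun w => ?_, fun x => ?_⟩
  · dsimp only
    split_ifs
    · exact hφ _
    · simp
  · have hw : ∃ z : X, prefixWord z.val N = prefixWord x.val N := ⟨x, rfl⟩
    simp only [hw, dif_pos]
    exact h _ _ hw.choose_spec.symm

theorem abs_birkhoff_sub_blockSum_le {X : Set (ℕ → B)} (hX : Set.MapsTo shift X X)
    {φ : X → ℝ} (hφ : ∀ x, φ x ∈ Set.Icc (0 : ℝ) 1) {F : List B → ℝ}
    (hF : ∀ w, F w ∈ Set.Icc (0 : ℝ) 1) {N : ℕ} {ε : ℝ} (hε : 0 ≤ ε)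
    (h : ∀ x : X, |φ x - F (prefixWord x.val N)| ≤ ε) (n : ℕ) (x : X) :
    |birkhoff (subShift X) φ n x - blockSum F N (prefixWord x.val n)| ≤ ε * n + min (n : ℝ) N := by
  induction n generalizing x with
  | zero => simp [birkhoff, prefixWord, blockSum]
  | succ n ih =>
    have hb : birkhoff (subShift X) φ (n + 1) x =
        φ x + birkhoff (subShift X) φ n (subShift X x) := by
      simp [birkhoff, Finset.sum_range_succ', add_comm]
    have hs : blockSum F N (prefixWord x.val (n + 1)) =
        F ((prefixWord x.val (n + 1)).take N) +
          blockSum F N (prefixWord (subShift X x).val n) := by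
      rw [prefixWord_succ, subShift_val hX, blockSum]
    have ih' := abs_le.1 (ih (subShift X x))
    rw [hb, hs, abs_le]
    push_cast
    by_cases hN : N ≤ n + 1
    · rw [take_prefixWord _ hN]
      have h1 := abs_le.1 (h x)
      have h2 : min (n : ℝ) N ≤ min ((n : ℝ) + 1) N := min_le_min_right _ (by simp)
      constructor <;> linarith [h1.1, h1.2, ih'.1, ih'.2]
    · have h1 : min (n : ℝ) N = n := min_eq_left (by exact_mod_cast (by omega))
      have h2 : min ((n : ℝ) + 1) N = n + 1 :=
        min_eq_left (by exact_mod_cast (by omega : n + 1 ≤ N))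
      rw [h1] at ih'
      rw [h2]
      have h3 := hF ((prefixWord x.val (n + 1)).take N)
      have h4 := hφ x
      constructor <;> linarith [h3.1, h3.2, h4.1, h4.2, ih'.1, ih'.2]

theorem birkhoff_mem_Icc {Y : Type*} (σ : Y → Y) {φ : Y → ℝ}
    (hφ : ∀ x, φ x ∈ Set.Icc (0 : ℝ) 1) (n : ℕ) (x : Y) :
    birkhoff σ φ n x ∈ Set.Icc (0 : ℝ) n := by
  refine ⟨Finset.sum_nonneg fun i _ => (hφ _).1, ?_⟩
  simpa [birkhoff] using Finset.sum_le_sum (fun i (_ : i ∈ Finset.range n) => (hφ (σ^[i] x)).2)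

theorem birkAvg_mem_Icc {Y : Type*} (σ : Y → Y) {φ : Y → ℝ}
    (hφ : ∀ x, φ x ∈ Set.Icc (0 : ℝ) 1) (n : ℕ) (x : Y) :
    birkAvg σ φ n x ∈ Set.Icc (0 : ℝ) 1 := by
  have h := birkhoff_mem_Icc σ hφ n x
  have hn : (0 : ℝ) ≤ n := n.cast_nonneg
  rw [birkAvg, inv_mul_eq_div]
  exact ⟨div_nonneg h.1 hn, div_le_one_of_le₀ h.2 hn⟩

theorem abs_birkAvg_sub_birkAvg_le {Y : Type*} (σ : Y → Y) {φ : Y → ℝ}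
    (hφ : ∀ x, φ x ∈ Set.Icc (0 : ℝ) 1) {n : ℕ} (hn : 0 < n) (m : ℕ) (x y : Y) :
    |birkAvg σ φ n x - birkAvg σ φ m y| ≤
      (|birkhoff σ φ n x - birkhoff σ φ m y| + |(n : ℝ) - m|) / n := by
  have hn' : (0 : ℝ) < n := by exact_mod_cast hn
  have hb : birkAvg σ φ m y * m = birkhoff σ φ m y := by
    rcases Nat.eq_zero_or_pos m with rfl | hm
    · simp [birkhoff]
    · have : (m : ℝ) ≠ 0 := by exact_mod_cast hm.ne'
      rw [birkAvg]
      field_simp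
  have ha := birkAvg_mem_Icc σ hφ m y
  have hd : birkAvg σ φ n x * n = birkhoff σ φ n x := by
    rw [birkAvg]
    field_simp
  rw [le_div_iff₀ hn', ← abs_of_pos hn', ← abs_mul, abs_of_pos hn']
  have e : (birkAvg σ φ n x - birkAvg σ φ m y) * n =
      (birkhoff σ φ n x - birkhoff σ φ m y) - birkAvg σ φ m y * (n - m) := by
    rw [← hd, ← hb]
    ring
  rw [e]
  refine (abs_sub _ _).trans (add_le_add_right ?_ _)
  rw [abs_mul, abs_of_nonneg ha.1]
  exact mul_le_of_le_one_left (abs_nonneg _) ha.2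

theorem abs_birkhoff_sub_birkhoff_le {X : Set (ℕ → B)} (hX : Set.MapsTo shift X X)
    {φ : X → ℝ} (hφ : ∀ x, φ x ∈ Set.Icc (0 : ℝ) 1) {N : ℕ} {ε : ℝ} (hε : 0 ≤ ε)
    (h : ∀ x y : X, prefixWord x.val N = prefixWord y.val N → |φ x - φ y| ≤ ε)
    (n m : ℕ) (x y : X) :
    |birkhoff (subShift X) φ n x - birkhoff (subShift X) φ m y| ≤
      ε * (n + m) + 2 * N +
        (4 * N + 1) * editDist (prefixWord x.val n) (prefixWord y.val m) := by
  obtain ⟨F, hF, hφF⟩ := exists_blockFun hφ h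
  have h1 := abs_le.1 (abs_birkhoff_sub_blockSum_le hX hφ hF hε hφF n x)
  have h2 := abs_le.1 (abs_birkhoff_sub_blockSum_le hX hφ hF hε hφF m y)
  have h3 := abs_le.1 (abs_sub_le_mul_editDist (blockSum F N) (4 * N + 1)
    (fun _ _ => abs_blockSum_sub_le_of_editStep hF N) (prefixWord x.val n) (prefixWord y.val m))
  have h4 : min (n : ℝ) N ≤ N := min_le_right _ _
  have h5 : min (m : ℝ) N ≤ N := min_le_right _ _
  rw [abs_le]
  constructor <;> linarith [h1.1, h1.2, h2.1, h2.2, h3.1, h3.2]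

end Prefixes

theorem eventually_abs_birkAvg_sub_le {A : Type} [Finite A] [TopologicalSpace A]
    [DiscreteTopology A] {X : Set (ℕ → A)} (hXcl : IsClosed X) (hX : Set.MapsTo shift X X)
    {g : ℕ → ℕ} (hg : Tendsto (fun n => (g n : ℝ) / n) atTop (𝓝 0))
    (φ : C(X, ℝ)) (hφ : ∀ x, φ x ∈ Set.Icc (0 : ℝ) 1) {ε : ℝ} (hε : 0 < ε) :
    ∀ᶠ n : ℕ in atTop, ∀ (x y : X) (m : ℕ),
      editDist (prefixWord x.val n) (prefixWord y.val m) ≤ g n →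
      |birkAvg (subShift X) φ n x - birkAvg (subShift X) φ m y| ≤ ε := by
  obtain ⟨N, hN⟩ := exists_prefix_uniform hXcl φ (ε := ε / 4) (by positivity)
  have hlim : Tendsto (fun n : ℕ => ε / 4 * (2 + (g n : ℝ) / n) + (2 * N) / (n : ℝ) +
      (4 * N + 2) * ((g n : ℝ) / n)) atTop (𝓝 (ε / 4 * (2 + 0) + 0 + (4 * N + 2) * 0)) :=
    (((hg.const_add 2).const_mul _).add (tendsto_const_div_atTop_nhds_zero_nat _)).add
      (hg.const_mul _)
  filter_upwards [hlim.eventually_lt_const (by linarith : _ < ε), eventually_gt_atTop 0]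
    with n hn hn0 x y m hd
  have hn' : (0 : ℝ) < n := by exact_mod_cast hn0
  refine le_trans ?_ hn.le
  refine (abs_birkAvg_sub_birkAvg_le _ hφ hn0 m x y).trans ?_
  have h1 := abs_birkhoff_sub_birkhoff_le hX hφ (by positivity) hN n m x y
  have h2 := abs_length_sub_length_le_editDist (prefixWord x.val n) (prefixWord y.val m)
  rw [length_prefixWord, length_prefixWord] at h2
  have hd' : (editDist (prefixWord x.val n) (prefixWord y.val m) : ℝ) ≤ g n := by
    exact_mod_cast hd
  rw [div_le_iff₀ hn']
  have e : (ε / 4 * (2 + (g n : ℝ) / n) + (2 * N) / (n : ℝ) + (4 * N + 2) * ((g n : ℝ) / n)) * n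
      = ε / 4 * (2 * n + g n) + 2 * N + (4 * N + 2) * g n := by
    field_simp
  rw [e]
  have h3 : (m : ℝ) ≤ n + g n := by linarith [(abs_le.1 h2).1]
  have h4 : ε / 4 * (n + m) ≤ ε / 4 * (2 * n + g n) :=
    mul_le_mul_of_nonneg_left (by linarith) (by positivity)
  have h5 : (4 * N + 1 : ℝ) * editDist (prefixWord x.val n) (prefixWord y.val m) ≤
      (4 * N + 1) * g n := mul_le_mul_of_nonneg_left hd' (by positivity)
  linarith

theorem integral_empiric {Y : Type*} [MeasurableSpace Y] [MeasurableSingletonClass Y]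
    (σ : Y → Y) (φ : Y → ℝ) (n : ℕ) (x : Y) :
    ∫ y, φ y ∂(empiric σ n x) = birkAvg σ φ n x := by
  rw [empiric, integral_smul_measure, integral_finsetSum_measure
    (fun i _ => integrable_dirac (by simp))]
  simp [birkAvg, birkhoff]

/-- A bound for a nonnegative quantity that is uniformly at most `1` and eventually uniformly
small can be chosen as a null sequence. -/
theorem exists_tendsto_zero_bound {ι : Type*} (P : ℕ → ι → Prop) (c : ℕ → ι → ℝ)
    (hc1 : ∀ n i, c n i ≤ 1)
    (hc : ∀ ε > 0, ∀ᶠ n in atTop, ∀ i, P n i → c n i ≤ ε) :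
    ∃ b : ℕ → ℝ, (∀ n, b n ∈ Set.Icc (0 : ℝ) 1) ∧ Tendsto b atTop (𝓝 0) ∧
      ∀ n i, P n i → c n i ≤ b n := by
  set S : ℕ → Set ℝ := fun n => insert 0 (c n '' {i | P n i}) with hS
  have hbdd (n : ℕ) : BddAbove (S n) := by
    refine ⟨1, ?_⟩
    rintro _ (rfl | ⟨i, -, rfl⟩)
    · exact zero_le_one
    · exact hc1 n i
  have h0 (n : ℕ) : 0 ≤ sSup (S n) := le_csSup (hbdd n) (Set.mem_insert _ _)
  refine ⟨fun n => sSup (S n), fun n => ⟨h0 n, ?_⟩, ?_, fun n i hi =>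
    le_csSup (hbdd n) (Set.mem_insert_of_mem _ ⟨i, hi, rfl⟩)⟩
  · refine csSup_le (Set.insert_nonempty _ _) ?_
    rintro _ (rfl | ⟨i, -, rfl⟩)
    · exact zero_le_one
    · exact hc1 n i
  · refine tendsto_order.2 ⟨fun a ha => Eventually.of_forall fun n => ha.trans_le (h0 n),
      fun a ha => ?_⟩
    filter_upwards [hc (a / 2) (by linarith)] with n hn
    refine (csSup_le (Set.insert_nonempty _ _) ?_).trans_lt (half_lt_self ha)
    rintro _ (rfl | ⟨i, hi, rfl⟩)
    · linarith
    · exact hn i hi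

/-- empirical measures of edit-close prefixes are uniformly close in `D`. -/
theorem statement_4 {A : Type} [Fintype A] [DecidableEq A] [TopologicalSpace A]
    [DiscreteTopology A] [MeasurableSpace A] [BorelSpace A]
    (X : Set (ℕ → A)) (hXcl : IsClosed X) (hXinv : Set.MapsTo shift X X)
    (g : ℕ → ℕ) (hg : MistakeFun g)
    (f : ℕ → C(↥X, ℝ)) (hf01 : ∀ k x, f k x ∈ Set.Icc (0 : ℝ) 1) (hsep : Separating f) :
    ∃ δ : ℕ → ℝ, (∀ n, 0 < δ n) ∧ Tendsto δ atTop (𝓝 0) ∧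
      ∀ (x y : ↥X) (n m : ℕ),
        editDist (prefixWord x.val n) (prefixWord y.val m) ≤ g n →
        Dmetric f (empiric (subShift X) n x) (empiric (subShift X) m y) ≤ δ n := by

  have hb (k : ℕ) := exists_tendsto_zero_bound
    (fun (n : ℕ) (p : ↥X × ↥X × ℕ) =>
      editDist (prefixWord p.1.val n) (prefixWord p.2.1.val p.2.2) ≤ g n)
    (fun n p => |birkAvg (subShift X) (f k) n p.1 - birkAvg (subShift X) (f k) p.2.2 p.2.1|)
    (fun n p => by
      have h1 := birkAvg_mem_Icc (subShift X) (hf01 k) n p.1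
      have h2 := birkAvg_mem_Icc (subShift X) (hf01 k) p.2.2 p.2.1
      rw [abs_le]
      constructor <;> linarith [h1.1, h1.2, h2.1, h2.2])
    (fun ε hε => by
      filter_upwards [eventually_abs_birkAvg_sub_le hXcl hXinv hg.2 (f k) (hf01 k) hε]
        with n hn p hp
      exact hn _ _ _ hp)
  choose b hb01 hb0 hbd using hb
  have hgeom : Summable fun k : ℕ => ((2 : ℝ) ^ (k + 1))⁻¹ := by
    simpa using (summable_nat_add_iff 1).2 summable_geometric_two
  have hterm (n k : ℕ) : ((2 : ℝ) ^ (k + 1))⁻¹ * b k n ≤ ((2 : ℝ) ^ (k + 1))⁻¹ :=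
    mul_le_of_le_one_right (by positivity) (hb01 k n).2
  have hnonneg (n k : ℕ) : 0 ≤ ((2 : ℝ) ^ (k + 1))⁻¹ * b k n :=
    mul_nonneg (by positivity) (hb01 k n).1
  have hsum (n : ℕ) : Summable fun k : ℕ => ((2 : ℝ) ^ (k + 1))⁻¹ * b k n :=
    Summable.of_nonneg_of_le (hnonneg n) (hterm n) hgeom
  refine ⟨fun n => (∑' k : ℕ, ((2 : ℝ) ^ (k + 1))⁻¹ * b k n) + 1 / ((n : ℝ) + 1),
    fun n => add_pos_of_nonneg_of_pos (tsum_nonneg (hnonneg n)) (by positivity), ?_, ?_⟩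
  · have h1 : Tendsto (fun n => ∑' k : ℕ, ((2 : ℝ) ^ (k + 1))⁻¹ * b k n) atTop
        (𝓝 (∑' k : ℕ, ((2 : ℝ) ^ (k + 1))⁻¹ * 0)) :=
      tendsto_tsum_of_dominated_convergence hgeom (fun k => (hb0 k).const_mul _)
        (Eventually.of_forall fun n k => by
          rw [Real.norm_of_nonneg (hnonneg n k)]
          exact hterm n k)
    simpa using h1.add (tendsto_one_div_add_atTop_nhds_zero_nat (𝕜 := ℝ))
  · intro x y n m hd
    have hle (k : ℕ) : ((2 : ℝ) ^ (k + 1))⁻¹ *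
        |(∫ z, f k z ∂(empiric (subShift X) n x)) - ∫ z, f k z ∂(empiric (subShift X) m y)| ≤
        ((2 : ℝ) ^ (k + 1))⁻¹ * b k n := by
      rw [integral_empiric, integral_empiric]
      exact mul_le_mul_of_nonneg_left (hbd k n (x, y, m) hd) (by positivity)
    have hD : Dmetric f (empiric (subShift X) n x) (empiric (subShift X) m y) ≤
        ∑' k : ℕ, ((2 : ℝ) ^ (k + 1))⁻¹ * b k n :=
      (Summable.of_nonneg_of_le (fun k => by positivity) hle (hsum n)).tsum_le_tsum hle (hsum n)
    exact hD.trans (le_add_of_nonneg_right (by positivity))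

end Paper
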